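/- The function x ↦ ψ'(x) e^{ψ(x)} tends to 1 as x → ∞, where ψ is the digamma function and ψ' is its derivative. -/

import Mathlib

open Filter

/-- The digamma function `ψ = Γ'/Γ`, as the derivative of `log ∘ Γ`. -/
noncomputable def digamma (x : ℝ) : ℝ := deriv (fun y : ℝ => Real.log (Real.Gamma y)) x

/-- The trigamma function `ψ'`. -/
noncomputable def trigamma (x : ℝ) : ℝ := deriv digamma x

theorem contDiffAt_log_Gamma {x : ℝ} (hx : 0 < x) :
    ContDiffAt ℝ 2 (fun y : ℝ => Real.log (Real.Gamma y)) x := by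
  have hopen : IsOpen {z : ℂ | 0 < z.re} := isOpen_lt continuous_const Complex.continuous_re
  have hd : DifferentiableOn ℂ Complex.Gamma {z : ℂ | 0 < z.re} := by
    intro z hz
    refine (Complex.differentiableAt_Gamma z fun m hm => ?_).differentiableWithinAt
    have h : 0 < z.re := hz
    rw [hm] at h
    simp only [Complex.neg_re, Complex.natCast_re] at h
    linarith [(Nat.cast_nonneg m : (0 : ℝ) ≤ m)]
  have hG : ContDiffAt ℂ 2 Complex.Gamma (x : ℂ) :=
    (hd.contDiffOn hopen).contDiffAt (hopen.mem_nhds (by simpa using hx))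
  have hR : ContDiffAt ℝ 2 Real.Gamma x := by
    simpa only [Complex.Gamma_ofReal, Complex.ofReal_re] using hG.real_of_complex
  exact hR.log (Real.Gamma_pos_of_pos hx).ne'

theorem hasDerivAt_log_Gamma {x : ℝ} (hx : 0 < x) :
    HasDerivAt (fun y : ℝ => Real.log (Real.Gamma y)) (digamma x) x :=
  ((contDiffAt_log_Gamma hx).differentiableAt (by norm_num)).hasDerivAt

theorem hasDerivAt_digamma {x : ℝ} (hx : 0 < x) : HasDerivAt digamma (trigamma x) x := by
  have h : ContDiffAt ℝ 1 (deriv fun y : ℝ => Real.log (Real.Gamma y)) x :=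
    (contDiffAt_log_Gamma hx).derivWithin (by norm_num)
  exact (h.differentiableAt (by norm_num)).hasDerivAt

theorem log_Gamma_add_one {x : ℝ} (hx : 0 < x) :
    Real.log (Real.Gamma (x + 1)) = Real.log x + Real.log (Real.Gamma x) := by
  rw [Real.Gamma_add_one hx.ne', Real.log_mul hx.ne' (Real.Gamma_pos_of_pos hx).ne']

theorem digamma_add_one {x : ℝ} (hx : 0 < x) : digamma (x + 1) = digamma x + x⁻¹ := by
  have h₁ : HasDerivAt (fun y : ℝ => Real.log (Real.Gamma (y + 1))) (digamma (x + 1)) x :=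
    (hasDerivAt_log_Gamma (by linarith : 0 < x + 1)).comp_add_const x 1
  have h₂ := (Real.hasDerivAt_log hx.ne').add (hasDerivAt_log_Gamma hx)
  have h₃ := h₂.congr_of_eventuallyEq
    (f₁ := fun y : ℝ => Real.log (Real.Gamma (y + 1)))
    ((eventually_gt_nhds hx).mono fun y hy => log_Gamma_add_one hy)
  rw [h₁.unique h₃, add_comm]

theorem digamma_le_log {x : ℝ} (hx : 0 < x) : digamma x ≤ Real.log x := by
  have h := Real.convexOn_log_Gamma.le_slope_of_hasDerivAt (Set.mem_Ioi.2 hx)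
    (Set.mem_Ioi.2 (by linarith : 0 < x + 1)) (lt_add_one x) (hasDerivAt_log_Gamma hx)
  simpa [slope_def_field, log_Gamma_add_one hx] using h

theorem log_le_digamma_add_one {x : ℝ} (hx : 0 < x) : Real.log x ≤ digamma (x + 1) := by
  have hx' : 0 < x + 1 := by linarith
  have h := Real.convexOn_log_Gamma.slope_le_of_hasDerivAt (Set.mem_Ioi.2 hx)
    (Set.mem_Ioi.2 hx') (lt_add_one x) (hasDerivAt_log_Gamma hx')
  simpa [slope_def_field, log_Gamma_add_one hx] using h

theorem tendsto_digamma_sub_log :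
    Tendsto (fun x : ℝ => digamma x - Real.log x) atTop (nhds 0) := by
  refine tendsto_of_tendsto_of_tendsto_of_le_of_le'
    (Real.tendsto_log_comp_add_sub_log (-1)) tendsto_const_nhds ?_ ?_
  · filter_upwards [eventually_gt_atTop 1] with x hx
    have h := log_le_digamma_add_one (by linarith : 0 < x + -1)
    rw [neg_add_cancel_right] at h
    linarith
  · filter_upwards [eventually_gt_atTop 0] with x hx
    linarith [digamma_le_log hx]

theorem tendsto_digamma_add_sub_digamma (h : ℝ) :
    Tendsto (fun x : ℝ => digamma (x + h) - digamma x) atTop (nhds 0) := by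
  have h₁ := tendsto_digamma_sub_log.comp (tendsto_atTop_add_const_right atTop h tendsto_id)
  have h₂ := (h₁.add (Real.tendsto_log_comp_add_sub_log h)).sub tendsto_digamma_sub_log
  simp only [add_zero, sub_zero] at h₂
  refine h₂.congr fun x => ?_
  simp only [Function.comp_apply, id_eq]
  ring

/-- A function that decreases under unit steps to the right of `x` and tends to zero at infinity is
nonnegative at `x`. -/
theorem nonneg_of_add_one_le_of_tendsto_zero {F : ℝ → ℝ} {x : ℝ}
    (hF : ∀ y, x ≤ y → F (y + 1) ≤ F y) (hlim : Tendsto F atTop (nhds 0)) : 0 ≤ F x := by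
  have hanti : Antitone fun n : ℕ => F (x + n) := antitone_nat_of_succ_le fun n => by
    have := hF (x + n) (by linarith [(Nat.cast_nonneg n : (0 : ℝ) ≤ n)])
    rwa [add_assoc, ← Nat.cast_succ] at this
  have h := hanti.le_of_tendsto
    (hlim.comp (tendsto_atTop_add_const_left atTop x tendsto_natCast_atTop_atTop)) 0
  simpa using h

theorem tendsto_const_div_add (h a : ℝ) :
    Tendsto (fun x : ℝ => h / (x + a)) atTop (nhds 0) :=
  (tendsto_atTop_add_const_right atTop a tendsto_id).const_div_atTop h

theorem div_le_digamma_sub {x h : ℝ} (hx : 0 < x) (hh : 0 < h) :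
    h / (x + h) ≤ digamma (x + h) - digamma x := by
  have key := nonneg_of_add_one_le_of_tendsto_zero
    (F := fun y => digamma (y + h) - digamma y - h / (y + h)) (x := x) ?_ ?_
  · exact sub_nonneg.1 key
  · intro y hy
    have hy₀ : 0 < y := hx.trans_le hy
    have e : y + 1 + h = y + h + 1 := by ring
    simp only [e, digamma_add_one hy₀, digamma_add_one (add_pos hy₀ hh)]
    have : 0 ≤ y⁻¹ - (y + h)⁻¹ - h / (y + h) + h / (y + h + 1) := by
      have : y⁻¹ - (y + h)⁻¹ - h / (y + h) + h / (y + h + 1) =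
          h * (h + 1) / (y * (y + h) * (y + h + 1)) := by
        field_simp
        ring
      rw [this]
      positivity
    linarith
  · simpa using (tendsto_digamma_add_sub_digamma h).sub (tendsto_const_div_add h h)

theorem digamma_sub_le_div {x h : ℝ} (hx : 1 < x) (hh : 0 < h) :
    digamma (x + h) - digamma x ≤ h / (x - 1) := by
  have key := nonneg_of_add_one_le_of_tendsto_zero
    (F := fun y => h / (y - 1) - (digamma (y + h) - digamma y)) (x := x) ?_ ?_
  · exact sub_nonneg.1 key
  · intro y hy
    have hy₁ : 0 < y - 1 := by linarith
    have hy₀ : 0 < y := by linarith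
    have e : y + 1 + h = y + h + 1 := by ring
    simp only [e, digamma_add_one hy₀, digamma_add_one (add_pos hy₀ hh), add_sub_cancel_right]
    have : 0 ≤ h / (y - 1) - h / y - (y⁻¹ - (y + h)⁻¹) := by
      have : h / (y - 1) - h / y - (y⁻¹ - (y + h)⁻¹) =
          h * (h + 1) / ((y - 1) * y * (y + h)) := by
        field_simp
        ring
      rw [this]
      positivity
    linarith
  · simpa [sub_eq_add_neg] using
      (tendsto_const_div_add h (-1)).sub (tendsto_digamma_add_sub_digamma h)

theorem inv_le_trigamma {x : ℝ} (hx : 0 < x) : x⁻¹ ≤ trigamma x := by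
  have hlim : Tendsto (fun h : ℝ => (x + h)⁻¹) (nhdsWithin 0 (Set.Ioi 0)) (nhds x⁻¹) := by
    have : ContinuousAt (fun h : ℝ => (x + h)⁻¹) 0 := by
      refine ContinuousAt.inv₀ (by fun_prop) (by simpa using hx.ne')
    simpa using this.tendsto.mono_left nhdsWithin_le_nhds
  refine le_of_tendsto_of_tendsto hlim (hasDerivAt_digamma hx).tendsto_slope_zero_right ?_
  filter_upwards [self_mem_nhdsWithin] with h (hh : 0 < h)
  rw [smul_eq_mul, inv_mul_eq_div, le_div_iff₀ hh, inv_mul_eq_div]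
  exact div_le_digamma_sub hx hh

theorem trigamma_le_inv {x : ℝ} (hx : 1 < x) : trigamma x ≤ (x - 1)⁻¹ := by
  refine le_of_tendsto (hasDerivAt_digamma (by linarith)).tendsto_slope_zero_right ?_
  filter_upwards [self_mem_nhdsWithin] with h (hh : 0 < h)
  rw [smul_eq_mul, inv_mul_eq_div, div_le_iff₀ hh, inv_mul_eq_div]
  exact digamma_sub_le_div hx hh

theorem tendsto_mul_trigamma :
    Tendsto (fun x : ℝ => x * trigamma x) atTop (nhds 1) := by
  have hup : Tendsto (fun x : ℝ => 1 + 1 / (x + -1)) atTop (nhds 1) := by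
    simpa using (tendsto_const_div_add 1 (-1)).const_add 1
  refine tendsto_of_tendsto_of_tendsto_of_le_of_le' tendsto_const_nhds hup ?_ ?_
  · filter_upwards [eventually_gt_atTop 0] with x hx
    have := mul_le_mul_of_nonneg_left (inv_le_trigamma hx) hx.le
    rwa [mul_inv_cancel₀ hx.ne'] at this
  · filter_upwards [eventually_gt_atTop 1] with x hx
    have hx₁ : x - 1 ≠ 0 := by linarith
    calc x * trigamma x ≤ x * (x - 1)⁻¹ :=
          mul_le_mul_of_nonneg_left (trigamma_le_inv hx) (by linarith)
      _ = 1 + 1 / (x + -1) := by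
          rw [← sub_eq_add_neg]
          field_simp
          ring

/-- `ψ'(x) e^{ψ(x)} → 1` as `x → ∞`. -/
theorem trigamma_mul_exp_digamma_tendsto_one :
    Tendsto (fun x : ℝ => trigamma x * Real.exp (digamma x)) atTop (nhds 1) := by
  have h := tendsto_mul_trigamma.mul
    ((Real.continuous_exp.tendsto 0).comp tendsto_digamma_sub_log)
  rw [Real.exp_zero, mul_one] at h
  refine h.congr' ?_
  filter_upwards [eventually_gt_atTop 0] with x hx
  rw [Function.comp_apply, Real.exp_sub, Real.exp_log hx]
  field_simp
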